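/- On (ℂ²)^{⊗6} realize fermion operators c_r (r = 1,…,6) by the Jordan–Wigner construction c_r = (∏_{j<r}(−σ^z_j)) σ⁻_r, and consider the two closed loops C : 1 → 3 → 4 → 2 → 1 and C' : 1 → 5 → 6 → 2 → 1, which share the link (2,1). Let 𝒜 be the unital subalgebra of the 64×64 complex matrices generated by the hopping bonds c_r† c_{r'} over all ordered pairs (r, r') such that r → r' is a directed link of C or C'. Then there is no injective unital ℂ-algebra homomorphism Φ : 𝒜 → M_{64}(ℂ) satisfying Φ(c_r† c_{r'}) = σ⁺_r σ⁻_{r'} for every such pair (r,r'). Indeed, any unital algebra homomorphism Φ with these values on generators maps both nested-anticommutator loop operators F_C = (n₂ − n₁)²(1 − 2n₃)(1 − 2n₄) and F_{C'} = (n₂ − n₁)²(1 − 2n₅)(1 − 2n₆) to the same operator (1/2)(1 − σ^z_1 σ^z_2), although F_C ≠ F_{C'}; hence no such Φ is injective, and there is no bond-algebra isomorphism mapping nearest-neighbor fermion hoppings to nearest-neighbor spin bonds on a lattice containing two closed loops that share a link. -/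

import Mathlib

open Matrix

noncomputable def pauliX : Matrix (Fin 2) (Fin 2) ℂ := !![0, 1; 1, 0]

noncomputable def pauliZ : Matrix (Fin 2) (Fin 2) ℂ := !![1, 0; 0, -1]

/-- The operator acting as the 2×2 matrix `A` on the (1-based) `k`-th tensor factor of
`(ℂ²)^{⊗N} ≅ ℂ^{2^N}` and as the identity on all other factors. -/
noncomputable def siteOp (N : ℕ) (A : Matrix (Fin 2) (Fin 2) ℂ) (k : ℕ) :
    Matrix (Fin N → Fin 2) (Fin N → Fin 2) ℂ :=
  if h : 1 ≤ k ∧ k ≤ N then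
    Matrix.of fun f g =>
      A (f ⟨k - 1, by omega⟩) (g ⟨k - 1, by omega⟩) *
        ∏ j ∈ Finset.univ.erase (⟨k - 1, by omega⟩ : Fin N),
          (if f j = g j then (1 : ℂ) else 0)
  else 1

noncomputable def sigmaPlus : Matrix (Fin 2) (Fin 2) ℂ := !![0, 1; 0, 0]

noncomputable def sigmaMinus : Matrix (Fin 2) (Fin 2) ℂ := !![0, 0; 1, 0]

/-- The Jordan–Wigner fermion operator `c_i = (∏_{j=1}^{i-1} (−σ^z_j)) σ⁻_i`. -/
noncomputable def cOp (N i : ℕ) : Matrix (Fin N → Fin 2) (Fin N → Fin 2) ℂ :=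
  (((List.range (i - 1)).map fun j => -siteOp N pauliZ (j + 1)).prod) * siteOp N sigmaMinus i

/-- The number operator `n_i = c_i† c_i`. -/
noncomputable def nOp (N i : ℕ) : Matrix (Fin N → Fin 2) (Fin N → Fin 2) ℂ :=
  (cOp N i)ᴴ * cOp N i

/-- The anticommutator `{A, B} = A B + B A`. -/
def antiC {α : Type*} [Ring α] (A B : α) : α := A * B + B * A

/-- The hopping bond `c_r† c_s` on six sites. -/
noncomputable def hop (r s : ℕ) : Matrix (Fin 6 → Fin 2) (Fin 6 → Fin 2) ℂ :=
  (cOp 6 r)ᴴ * cOp 6 s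

/-- The directed links of the two loops `C : 1 → 3 → 4 → 2 → 1` and
`C' : 1 → 5 → 6 → 2 → 1`, which share the link `(2,1)`. -/
def loopLinks : List (ℕ × ℕ) := [(1, 3), (3, 4), (4, 2), (2, 1), (1, 5), (5, 6), (6, 2)]

/-- The set of hopping bonds over the directed links of the two loops. -/
def bondSet : Set (Matrix (Fin 6 → Fin 2) (Fin 6 → Fin 2) ℂ) :=
  {m | ∃ p ∈ loopLinks, m = hop p.1 p.2}

/-- The loop operator `F_C` of `C : 1 → 3 → 4 → 2 → 1` (nested anticommutator). -/
noncomputable def loopFC : Matrix (Fin 6 → Fin 2) (Fin 6 → Fin 2) ℂ :=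
  antiC (antiC (antiC (hop 1 3) (hop 3 4)) (hop 4 2)) (hop 2 1)

/-- The loop operator `F_{C'}` of `C' : 1 → 5 → 6 → 2 → 1` (nested anticommutator). -/
noncomputable def loopFC' : Matrix (Fin 6 → Fin 2) (Fin 6 → Fin 2) ℂ :=
  antiC (antiC (antiC (hop 1 5) (hop 5 6)) (hop 6 2)) (hop 2 1)

lemma hop_mem_adjoin (p : ℕ × ℕ) (hp : p ∈ loopLinks) :
    hop p.1 p.2 ∈ Algebra.adjoin ℂ bondSet :=
  Algebra.subset_adjoin ⟨p, hp, rfl⟩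

lemma antiC_mem {S : Subalgebra ℂ (Matrix (Fin 6 → Fin 2) (Fin 6 → Fin 2) ℂ)}
    {A B : Matrix (Fin 6 → Fin 2) (Fin 6 → Fin 2) ℂ} (hA : A ∈ S) (hB : B ∈ S) :
    antiC A B ∈ S := by
  unfold antiC
  exact add_mem (mul_mem hA hB) (mul_mem hB hA)

lemma loopFC_mem : loopFC ∈ Algebra.adjoin ℂ bondSet := by
  unfold loopFC
  exact antiC_mem (antiC_mem (antiC_mem (hop_mem_adjoin (1, 3) (by decide))
      (hop_mem_adjoin (3, 4) (by decide))) (hop_mem_adjoin (4, 2) (by decide)))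
    (hop_mem_adjoin (2, 1) (by decide))

lemma loopFC'_mem : loopFC' ∈ Algebra.adjoin ℂ bondSet := by
  unfold loopFC'
  exact antiC_mem (antiC_mem (antiC_mem (hop_mem_adjoin (1, 5) (by decide))
      (hop_mem_adjoin (5, 6) (by decide))) (hop_mem_adjoin (6, 2) (by decide)))
    (hop_mem_adjoin (2, 1) (by decide))

/-- The tensor product of a family of one-site operators. -/
noncomputable def tensorOp {N : ℕ} :
    (Fin N → Matrix (Fin 2) (Fin 2) ℂ) →* Matrix (Fin N → Fin 2) (Fin N → Fin 2) ℂ where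
  toFun A := Matrix.of fun f g => ∏ j, A j (f j) (g j)
  map_one' := by
    ext f g
    simp only [Matrix.of_apply, Pi.one_apply, Matrix.one_apply, Finset.prod_ite_zero,
      Finset.prod_const_one, funext_iff, Finset.mem_univ, true_implies]
  map_mul' A B := by
    ext f g
    simp only [Matrix.of_apply, Matrix.mul_apply, Pi.mul_apply, Finset.prod_univ_sum,
      Fintype.piFinset_univ, Finset.prod_mul_distrib]

section TensorOp

variable {N : ℕ}

lemma tensorOp_apply (A : Fin N → Matrix (Fin 2) (Fin 2) ℂ) (f g : Fin N → Fin 2) :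
    tensorOp A f g = ∏ j, A j (f j) (g j) := rfl

lemma tensorOp_conjTranspose (A : Fin N → Matrix (Fin 2) (Fin 2) ℂ) :
    (tensorOp A)ᴴ = tensorOp fun j => (A j)ᴴ := by
  ext f g
  simp [tensorOp_apply, Matrix.conjTranspose_apply]

lemma tensorOp_eq_neg {A B : Fin N → Matrix (Fin 2) (Fin 2) ℂ} (i : Fin N)
    (hi : A i = -B i) (h : ∀ j, j ≠ i → A j = B j) : tensorOp A = -tensorOp B := by
  ext f g
  rw [Matrix.neg_apply, tensorOp_apply, tensorOp_apply,
    ← Finset.mul_prod_erase _ _ (Finset.mem_univ i),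
    ← Finset.mul_prod_erase Finset.univ (fun j => B j (f j) (g j)) (Finset.mem_univ i), hi,
    Finset.prod_congr rfl fun j hj => by rw [h j (Finset.ne_of_mem_erase hj)]]
  simp

lemma tensorOp_anticommute {A B : Fin N → Matrix (Fin 2) (Fin 2) ℂ} (i : Fin N)
    (hi : A i * B i = -(B i * A i)) (h : ∀ j, j ≠ i → A j * B j = B j * A j) :
    tensorOp A * tensorOp B = -(tensorOp B * tensorOp A) := by
  rw [← map_mul, ← map_mul]
  exact tensorOp_eq_neg i hi h

lemma tensorOp_eq_zero {A : Fin N → Matrix (Fin 2) (Fin 2) ℂ} (i : Fin N) (hi : A i = 0) :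
    tensorOp A = 0 := by
  ext f g
  exact Finset.prod_eq_zero (Finset.mem_univ i) (by simp [hi])

lemma siteOp_eq_tensorOp (A : Matrix (Fin 2) (Fin 2) ℂ) (i : Fin N) :
    siteOp N A (i + 1) = tensorOp (Pi.mulSingle i A) := by
  ext f g
  rw [siteOp, dif_pos ⟨by omega, by omega⟩, Matrix.of_apply, tensorOp_apply,
    ← Finset.mul_prod_erase _ _ (Finset.mem_univ i)]
  simp only [Nat.add_sub_cancel, Pi.mulSingle_eq_same]
  congr 1
  refine Finset.prod_congr rfl fun j hj => ?_
  rw [Pi.mulSingle_eq_of_ne (Finset.ne_of_mem_erase hj), Matrix.one_apply]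

lemma siteOp_mul (A B : Matrix (Fin 2) (Fin 2) ℂ) (i : Fin N) :
    siteOp N A (i + 1) * siteOp N B (i + 1) = siteOp N (A * B) (i + 1) := by
  simp only [siteOp_eq_tensorOp, ← map_mul, Pi.mulSingle_mul]

lemma siteOp_one (i : Fin N) : siteOp N 1 (i + 1) = 1 := by
  rw [siteOp_eq_tensorOp, Pi.mulSingle_one, map_one]

lemma siteOp_add (A B : Matrix (Fin 2) (Fin 2) ℂ) (i : Fin N) :
    siteOp N (A + B) (i + 1) = siteOp N A (i + 1) + siteOp N B (i + 1) := by
  ext f g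
  simp [siteOp, add_mul]

lemma siteOp_smul (z : ℂ) (A : Matrix (Fin 2) (Fin 2) ℂ) (i : Fin N) :
    siteOp N (z • A) (i + 1) = z • siteOp N A (i + 1) := by
  ext f g
  simp [siteOp, mul_assoc]

lemma siteOp_commute (A B : Matrix (Fin 2) (Fin 2) ℂ) {i j : Fin N} (h : i ≠ j) :
    Commute (siteOp N A (i + 1)) (siteOp N B (j + 1)) := by
  rw [siteOp_eq_tensorOp, siteOp_eq_tensorOp]
  rw [Commute, SemiconjBy, ← map_mul, ← map_mul,
    (Pi.mulSingle_commute (f := fun _ : Fin N => Matrix (Fin 2) (Fin 2) ℂ) h A B).eq]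

end TensorOp

lemma conjTranspose_pauliZ : pauliZᴴ = pauliZ := by
  ext i j; fin_cases i <;> fin_cases j <;> simp [pauliZ]

lemma conjTranspose_sigmaMinus : sigmaMinusᴴ = sigmaPlus := by
  ext i j; fin_cases i <;> fin_cases j <;> simp [sigmaMinus, sigmaPlus]

lemma pauliZ_mul_self : pauliZ * pauliZ = 1 := by
  ext i j; fin_cases i <;> fin_cases j <;> simp [pauliZ]

lemma sigmaMinus_mul_self : sigmaMinus * sigmaMinus = 0 := by
  ext i j; fin_cases i <;> fin_cases j <;> simp [sigmaMinus]

lemma sigmaMinus_mul_pauliZ : sigmaMinus * pauliZ = -(pauliZ * sigmaMinus) := by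
  ext i j; fin_cases i <;> fin_cases j <;> simp [sigmaMinus, pauliZ]

lemma sigmaPlus_mul_pauliZ : sigmaPlus * pauliZ = -(pauliZ * sigmaPlus) := by
  ext i j; fin_cases i <;> fin_cases j <;> simp [sigmaPlus, pauliZ]

lemma sigmaPlus_mul_sigmaMinus :
    sigmaPlus * sigmaMinus = ((1 : ℂ) / 2) • (1 + pauliZ) := by
  ext i j
  fin_cases i <;> fin_cases j <;> norm_num [sigmaPlus, sigmaMinus, pauliZ]

lemma sigmaMinus_mul_sigmaPlus :
    sigmaMinus * sigmaPlus = ((1 : ℂ) / 2) • (1 + (-1 : ℂ) • pauliZ) := by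
  ext i j
  fin_cases i <;> fin_cases j <;> norm_num [sigmaPlus, sigmaMinus, pauliZ]

/-- The tensor factors of the Jordan–Wigner operator at site `i` (counted from zero). -/
noncomputable def jwFactor {N : ℕ} (i j : Fin N) : Matrix (Fin 2) (Fin 2) ℂ :=
  if j < i then -pauliZ else if j = i then sigmaMinus else 1

section JordanWigner

variable {N : ℕ}

lemma neg_siteOp_pauliZ (i : Fin N) :
    -siteOp N pauliZ (i + 1) = tensorOp (Pi.mulSingle i (-pauliZ)) := by
  rw [siteOp_eq_tensorOp]
  refine (tensorOp_eq_neg i (by simp) fun j hj => ?_).symm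
  simp [Pi.mulSingle_eq_of_ne hj]

lemma prod_range_neg_siteOp (n : ℕ) (hn : n ≤ N) :
    ((List.range n).map fun j => -siteOp N pauliZ (j + 1)).prod =
      tensorOp fun j : Fin N => if (j : ℕ) < n then -pauliZ else 1 := by
  induction n with
  | zero => exact (map_one (tensorOp (N := N))).symm
  | succ n ih =>
    rw [List.range_succ, List.map_append, List.prod_append, ih (by omega), List.map_singleton,
      List.prod_singleton, neg_siteOp_pauliZ ⟨n, hn⟩, ← map_mul]
    congr 1
    funext j
    rcases eq_or_ne j ⟨n, hn⟩ with rfl | hj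
    · simp
    · have : (j : ℕ) ≠ n := fun h => hj (Fin.ext h)
      have : (j : ℕ) < n + 1 ↔ (j : ℕ) < n := by omega
      simp [Pi.mulSingle_eq_of_ne hj, this]

lemma cOp_eq_tensorOp (i : Fin N) : cOp N (i + 1) = tensorOp (jwFactor i) := by
  rw [cOp, Nat.add_sub_cancel, prod_range_neg_siteOp _ i.2.le, siteOp_eq_tensorOp, ← map_mul]
  congr 1
  funext j
  rcases eq_or_ne j i with rfl | hj
  · simp [jwFactor]
  · simp [jwFactor, hj]

lemma cOp_mul_self (i : Fin N) : cOp N (i + 1) * cOp N (i + 1) = 0 := by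
  rw [cOp_eq_tensorOp, ← map_mul]
  exact tensorOp_eq_zero i (by simp [jwFactor, sigmaMinus_mul_self])

lemma cOp_mul_cOp_of_lt {i j : Fin N} (h : i < j) :
    cOp N (i + 1) * cOp N (j + 1) = -(cOp N (j + 1) * cOp N (i + 1)) := by
  simp only [cOp_eq_tensorOp]
  refine tensorOp_anticommute i (by simp [jwFactor, h, sigmaMinus_mul_pauliZ]) fun k hk => ?_
  simp only [jwFactor, hk, if_false]
  split_ifs <;> first | omega | simp

lemma cOp_mul_cOp {i j : Fin N} (h : i ≠ j) :
    cOp N (i + 1) * cOp N (j + 1) = -(cOp N (j + 1) * cOp N (i + 1)) := by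
  rcases h.lt_or_gt with h | h
  · exact cOp_mul_cOp_of_lt h
  · rw [cOp_mul_cOp_of_lt h, neg_neg]

lemma conjTranspose_cOp_mul_cOp_of_lt {i j : Fin N} (h : i < j) :
    (cOp N (i + 1))ᴴ * cOp N (j + 1) = -(cOp N (j + 1) * (cOp N (i + 1))ᴴ) := by
  simp only [cOp_eq_tensorOp, tensorOp_conjTranspose]
  refine tensorOp_anticommute i
    (by simp [jwFactor, h, conjTranspose_sigmaMinus, sigmaPlus_mul_pauliZ]) fun k hk => ?_
  simp only [jwFactor, hk, if_false]
  split_ifs <;> first | omega | simp [conjTranspose_pauliZ]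

lemma conjTranspose_cOp_mul_cOp {i j : Fin N} (h : i ≠ j) :
    (cOp N (i + 1))ᴴ * cOp N (j + 1) = -(cOp N (j + 1) * (cOp N (i + 1))ᴴ) := by
  rcases h.lt_or_gt with h | h
  · exact conjTranspose_cOp_mul_cOp_of_lt h
  · have := congrArg Matrix.conjTranspose (conjTranspose_cOp_mul_cOp_of_lt h)
    simp only [Matrix.conjTranspose_mul, Matrix.conjTranspose_neg,
      Matrix.conjTranspose_conjTranspose] at this
    rw [this]

lemma conjTranspose_cOp_mul_cOp_self (i : Fin N) :
    (cOp N (i + 1))ᴴ * cOp N (i + 1) = siteOp N (sigmaPlus * sigmaMinus) (i + 1) := by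
  rw [cOp_eq_tensorOp, tensorOp_conjTranspose, ← map_mul, siteOp_eq_tensorOp]
  congr 1
  funext j
  rcases eq_or_ne j i with rfl | hj
  · simp [jwFactor, conjTranspose_sigmaMinus]
  · by_cases h : j < i <;>
      simp [jwFactor, hj, h, conjTranspose_pauliZ, pauliZ_mul_self]

lemma cOp_mul_conjTranspose_cOp_self (i : Fin N) :
    cOp N (i + 1) * (cOp N (i + 1))ᴴ = siteOp N (sigmaMinus * sigmaPlus) (i + 1) := by
  rw [cOp_eq_tensorOp, tensorOp_conjTranspose, ← map_mul, siteOp_eq_tensorOp]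
  congr 1
  funext j
  rcases eq_or_ne j i with rfl | hj
  · simp [jwFactor, conjTranspose_sigmaMinus]
  · by_cases h : j < i <;>
      simp [jwFactor, hj, h, conjTranspose_pauliZ, pauliZ_mul_self]

lemma siteOp_sigmaPlus_mul_sigmaMinus (i : Fin N) :
    siteOp N (sigmaPlus * sigmaMinus) (i + 1) =
      ((1 : ℂ) / 2) • (1 + siteOp N pauliZ (i + 1)) := by
  rw [sigmaPlus_mul_sigmaMinus, siteOp_smul, siteOp_add, siteOp_one]

lemma siteOp_sigmaMinus_mul_sigmaPlus (i : Fin N) :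
    siteOp N (sigmaMinus * sigmaPlus) (i + 1) =
      ((1 : ℂ) / 2) • (1 - siteOp N pauliZ (i + 1)) := by
  rw [sigmaMinus_mul_sigmaPlus, siteOp_smul, siteOp_add, siteOp_one, siteOp_smul, neg_one_smul,
    sub_eq_add_neg]

lemma siteOp_sigma_anticommutator (i : Fin N) :
    siteOp N (sigmaPlus * sigmaMinus) (i + 1) + siteOp N (sigmaMinus * sigmaPlus) (i + 1) = 1 := by
  rw [siteOp_sigmaPlus_mul_sigmaMinus, siteOp_sigmaMinus_mul_sigmaPlus]
  module

lemma nOp_eq_diagonal (i : Fin N) :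
    nOp N (i + 1) = Matrix.diagonal fun f => if f i = 0 then 1 else 0 := by
  have h : sigmaPlus * sigmaMinus = Matrix.diagonal ![1, 0] := by
    ext i j; fin_cases i <;> fin_cases j <;> simp [sigmaPlus, sigmaMinus]
  rw [nOp, conjTranspose_cOp_mul_cOp_self, h, siteOp_eq_tensorOp]
  ext f g
  rw [tensorOp_apply]
  rcases eq_or_ne f g with rfl | hfg
  · rw [Matrix.diagonal_apply_eq, Finset.prod_eq_single i]
    · rw [Pi.mulSingle_eq_same, Matrix.diagonal_apply_eq]
      generalize f i = x
      fin_cases x <;> simp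
    · intro j _ hj
      simp [Pi.mulSingle_eq_of_ne hj]
    · simp
  · rw [Matrix.diagonal_apply_ne _ hfg]
    obtain ⟨j, hj⟩ := Function.ne_iff.mp hfg
    refine Finset.prod_eq_zero (Finset.mem_univ j) ?_
    rcases eq_or_ne j i with rfl | hji
    · simp [hj]
    · simp [Pi.mulSingle_eq_of_ne hji, hj]

end JordanWigner

section Loops

variable {R ι : Type*} [Ring R]

/-- The canonical anticommutation relations between `c` and its adjoints `d`. -/
structure IsCAR (c d : ι → R) : Prop where
  mul_self : ∀ i, c i * c i = 0
  mul_swap : ∀ i j, i ≠ j → c i * c j = -(c j * c i)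
  adj_swap : ∀ i j, i ≠ j → d i * d j = -(d j * d i)
  adj_mul : ∀ i j, i ≠ j → d i * c j = -(c j * d i)
  mul_adj_self : ∀ i, c i * d i = 1 - d i * c i

namespace IsCAR

variable {c d : ι → R}

lemma number_sq (h : IsCAR c d) (i : ι) : d i * c i * (d i * c i) = d i * c i := by
  rw [mul_assoc, ← mul_assoc (c i), h.mul_adj_self, sub_mul, mul_assoc (d i) (c i), h.mul_self]
  simp

lemma commute_number_mul (h : IsCAR c d) {i j : ι} (hij : i ≠ j) : Commute (d i * c i) (c j) := by
  rw [Commute, SemiconjBy, mul_assoc, h.mul_swap i j hij, mul_neg, ← mul_assoc,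
    h.adj_mul i j hij, neg_mul, neg_neg, mul_assoc]

lemma commute_number_adj (h : IsCAR c d) {i j : ι} (hij : i ≠ j) : Commute (d i * c i) (d j) := by
  rw [Commute, SemiconjBy, mul_assoc, ← neg_neg (c i * d j), ← h.adj_mul j i hij.symm, mul_neg,
    ← mul_assoc, h.adj_swap i j hij, neg_mul, neg_neg, mul_assoc]

lemma antiC_hop (h : IsCAR c d) {i j k : ι} (hij : i ≠ j) (hjk : j ≠ k) (hik : i ≠ k) :
    antiC (d i * c j) (d j * c k) = d i * c k * (1 - 2 * (d j * c j)) := by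
  have h₁ : d i * c j * (d j * c k) = d i * c k - d i * c k * (d j * c j) := by
    rw [mul_assoc, ← mul_assoc (c j), h.mul_adj_self, sub_mul, one_mul,
      (h.commute_number_mul hjk).eq, mul_sub, ← mul_assoc (d i)]
  have h₂ : d j * c k * (d i * c j) = -(d i * c k * (d j * c j)) := by
    rw [← neg_neg (d j * c k * (d i * c j)), mul_assoc, ← mul_assoc (c k),
      ← neg_neg (c k * d i), ← h.adj_mul i k hik, neg_mul, mul_neg, neg_neg, ← mul_assoc,
      ← mul_assoc, h.adj_swap j i hij.symm, neg_mul, neg_mul, mul_assoc (d i) (d j),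
      h.adj_mul j k hjk]
    noncomm_ring
  rw [antiC, h₁, h₂]
  noncomm_ring

lemma antiC_hop_swap (h : IsCAR c d) {i j : ι} (hij : i ≠ j) :
    antiC (d i * c j) (d j * c i) = (d j * c j - d i * c i) ^ 2 := by
  have h₁ : ∀ i j, i ≠ j → d i * c j * (d j * c i) = d i * c i - d i * c i * (d j * c j) := by
    intro i j hij
    rw [mul_assoc, ← mul_assoc (c j), h.mul_adj_self, sub_mul, one_mul,
      (h.commute_number_mul hij.symm).eq, mul_sub, ← mul_assoc (d i)]
  rw [antiC, h₁ i j hij, h₁ j i hij.symm, sq, sub_mul, mul_sub, mul_sub, h.number_sq,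
    h.number_sq]
  abel

lemma antiC_loop (h : IsCAR c d) {i j k l : ι} (hij : i ≠ j) (hik : i ≠ k) (hil : i ≠ l) (hjk : j ≠ k)
    (hjl : j ≠ l) (hkl : k ≠ l) :
    antiC (antiC (antiC (d i * c j) (d j * c k)) (d k * c l)) (d l * c i) =
      (d l * c l - d i * c i) ^ 2 * ((1 - 2 * (d j * c j)) * (1 - 2 * (d k * c k))) := by
  have antiC_mul {x y z : R} (hz : Commute z y) : antiC (x * z) y = antiC x y * z := by
    rw [antiC, antiC, mul_assoc, hz.eq, add_mul]
    simp only [mul_assoc]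
  have comm {m p q : ι} (hp : m ≠ p) (hq : m ≠ q) : Commute (1 - 2 * (d m * c m)) (d p * c q) :=
    (Commute.one_left _).sub_left (Commute.mul_left (Nat.cast_commute 2 _)
      ((h.commute_number_adj hp).mul_right (h.commute_number_mul hq)))
  rw [h.antiC_hop hij hjk hik, antiC_mul (comm hjk hjl), h.antiC_hop hik hkl hil,
    antiC_mul (comm hjl hij.symm), antiC_mul (comm hkl hik.symm), h.antiC_hop_swap hil,
    mul_assoc]
  congr 1
  exact (Commute.one_right _).sub_right
    ((Nat.commute_cast _ 2).mul_right (comm hjk.symm hjk.symm))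

end IsCAR

end Loops

lemma isCAR_cOp (N : ℕ) :
    IsCAR (fun i : Fin N => cOp N (i + 1)) (fun i : Fin N => (cOp N (i + 1))ᴴ) where
  mul_self := cOp_mul_self
  mul_swap _ _ := cOp_mul_cOp
  adj_swap i j hij := by
    rw [← Matrix.conjTranspose_mul, ← Matrix.conjTranspose_mul, cOp_mul_cOp hij.symm,
      Matrix.conjTranspose_neg]
  adj_mul _ _ := conjTranspose_cOp_mul_cOp
  mul_adj_self i := by
    rw [eq_sub_iff_add_eq', conjTranspose_cOp_mul_cOp_self, cOp_mul_conjTranspose_cOp_self,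
      siteOp_sigma_anticommutator]

/-- The spin bond `σ⁺_r σ⁻_s` on `N` sites. -/
noncomputable def spinBond (N r s : ℕ) : Matrix (Fin N → Fin 2) (Fin N → Fin 2) ℂ :=
  siteOp N sigmaPlus r * siteOp N sigmaMinus s

section SpinLoops

variable {N : ℕ}

lemma antiC_spinBond {i j k : Fin N} (hij : i ≠ j) (hjk : j ≠ k) (hik : i ≠ k) :
    antiC (spinBond N (i + 1) (j + 1)) (spinBond N (j + 1) (k + 1)) =
      spinBond N (i + 1) (k + 1) := by
  have h₁ : spinBond N (i + 1) (j + 1) * spinBond N (j + 1) (k + 1) =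
      spinBond N (i + 1) (k + 1) * siteOp N (sigmaMinus * sigmaPlus) (j + 1) := by
    rw [spinBond, spinBond, spinBond, mul_assoc, ← mul_assoc (siteOp N sigmaMinus _), siteOp_mul,
      (siteOp_commute _ _ hjk).eq, mul_assoc]
  have h₂ : spinBond N (j + 1) (k + 1) * spinBond N (i + 1) (j + 1) =
      spinBond N (i + 1) (k + 1) * siteOp N (sigmaPlus * sigmaMinus) (j + 1) := by
    rw [spinBond, spinBond, spinBond, (siteOp_commute sigmaPlus sigmaMinus hjk).eq, ← siteOp_mul,
      mul_assoc, ← mul_assoc (siteOp N sigmaPlus (j + 1)),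
      (siteOp_commute sigmaPlus sigmaPlus hij.symm).eq,
      (siteOp_commute sigmaPlus sigmaMinus hik).eq]
    simp only [mul_assoc]
  rw [antiC, h₁, h₂, ← mul_add, add_comm (siteOp N _ _), siteOp_sigma_anticommutator, mul_one]

lemma antiC_spinBond_swap {i j : Fin N} (hij : i ≠ j) :
    antiC (spinBond N (i + 1) (j + 1)) (spinBond N (j + 1) (i + 1)) =
      ((1 : ℂ) / 2) • (1 - siteOp N pauliZ (i + 1) * siteOp N pauliZ (j + 1)) := by
  have h : ∀ i j : Fin N, i ≠ j →
      spinBond N (i + 1) (j + 1) * spinBond N (j + 1) (i + 1) =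
        siteOp N (sigmaPlus * sigmaMinus) (i + 1) *
          siteOp N (sigmaMinus * sigmaPlus) (j + 1) := by
    intro i j hij
    rw [spinBond, spinBond, mul_assoc, ← mul_assoc (siteOp N sigmaMinus _), siteOp_mul,
      (siteOp_commute _ _ hij.symm).eq, ← mul_assoc, siteOp_mul]
  rw [antiC, h i j hij, h j i hij.symm, siteOp_sigmaPlus_mul_sigmaMinus,
    siteOp_sigmaPlus_mul_sigmaMinus, siteOp_sigmaMinus_mul_sigmaPlus,
    siteOp_sigmaMinus_mul_sigmaPlus]
  simp only [smul_mul_smul_comm, add_mul, mul_sub, one_mul, mul_one,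
    (siteOp_commute pauliZ pauliZ hij.symm).eq]
  module

lemma antiC_spinBond_loop {i j k l : Fin N} (hij : i ≠ j) (hik : i ≠ k) (hil : i ≠ l)
    (hjk : j ≠ k) (hkl : k ≠ l) :
    antiC (antiC (antiC (spinBond N (i + 1) (j + 1)) (spinBond N (j + 1) (k + 1)))
        (spinBond N (k + 1) (l + 1))) (spinBond N (l + 1) (i + 1)) =
      ((1 : ℂ) / 2) • (1 - siteOp N pauliZ (i + 1) * siteOp N pauliZ (l + 1)) := by
  rw [antiC_spinBond hij hjk hik, antiC_spinBond hik hkl hil, antiC_spinBond_swap hil]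

end SpinLoops

lemma map_antiC {R S F : Type*} [Ring R] [Ring S] [FunLike F R S] [RingHomClass F R S]
    (φ : F) (x y : R) : φ (antiC x y) = antiC (φ x) (φ y) := by
  simp [antiC]

lemma loopFC_eq : loopFC =
    (nOp 6 2 - nOp 6 1) ^ 2 * ((1 - (2 : ℂ) • nOp 6 3) * (1 - (2 : ℂ) • nOp 6 4)) := by
  rw [two_smul, two_smul, ← two_mul, ← two_mul]
  exact (isCAR_cOp 6).antiC_loop (i := 0) (j := 2) (k := 3) (l := 1) (by decide) (by decide)
    (by decide) (by decide) (by decide) (by decide)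

lemma loopFC'_eq : loopFC' =
    (nOp 6 2 - nOp 6 1) ^ 2 * ((1 - (2 : ℂ) • nOp 6 5) * (1 - (2 : ℂ) • nOp 6 6)) := by
  rw [two_smul, two_smul, ← two_mul, ← two_mul]
  exact (isCAR_cOp 6).antiC_loop (i := 0) (j := 4) (k := 5) (l := 1) (by decide) (by decide)
    (by decide) (by decide) (by decide) (by decide)

lemma loopFC_ne_loopFC' : loopFC ≠ loopFC' := by
  have h₁ : nOp 6 1 = _ := nOp_eq_diagonal (N := 6) 0
  have h₂ : nOp 6 2 = _ := nOp_eq_diagonal (N := 6) 1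
  have h₃ : nOp 6 3 = _ := nOp_eq_diagonal (N := 6) 2
  have h₄ : nOp 6 4 = _ := nOp_eq_diagonal (N := 6) 3
  have h₅ : nOp 6 5 = _ := nOp_eq_diagonal (N := 6) 4
  have h₆ : nOp 6 6 = _ := nOp_eq_diagonal (N := 6) 5
  intro h
  rw [loopFC_eq, loopFC'_eq, h₁, h₂, h₃, h₄, h₅, h₆, ← Matrix.diagonal_one] at h
  simp only [← Matrix.diagonal_smul, Matrix.diagonal_sub, Matrix.diagonal_mul_diagonal, sq] at h
  have := congrFun (Matrix.diagonal_injective h) ![0, 1, 0, 1, 1, 1]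
  simp at this

lemma map_loop {Φ : ↥(Algebra.adjoin ℂ bondSet) →ₐ[ℂ] Matrix (Fin 6 → Fin 2) (Fin 6 → Fin 2) ℂ}
    (hΦ : ∀ (p : ℕ × ℕ) (hp : p ∈ loopLinks),
      Φ ⟨hop p.1 p.2, hop_mem_adjoin p hp⟩ = siteOp 6 sigmaPlus p.1 * siteOp 6 sigmaMinus p.2)
    (p q r s : ℕ × ℕ) (hp : p ∈ loopLinks) (hq : q ∈ loopLinks) (hr : r ∈ loopLinks)
    (hs : s ∈ loopLinks) :
    Φ ⟨antiC (antiC (antiC (hop p.1 p.2) (hop q.1 q.2)) (hop r.1 r.2)) (hop s.1 s.2),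
        antiC_mem (antiC_mem (antiC_mem (hop_mem_adjoin p hp) (hop_mem_adjoin q hq))
          (hop_mem_adjoin r hr)) (hop_mem_adjoin s hs)⟩ =
      antiC (antiC (antiC (spinBond 6 p.1 p.2) (spinBond 6 q.1 q.2)) (spinBond 6 r.1 r.2))
        (spinBond 6 s.1 s.2) := by
  simp only [spinBond, ← hΦ p hp, ← hΦ q hq, ← hΦ r hr, ← hΦ s hs, ← map_antiC]
  rfl

/-- **No bond-algebra isomorphism maps nearest-neighbor fermion hoppings to
nearest-neighbor spin bonds on a lattice with two closed loops sharing a link.** -/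
theorem no_injective_fermion_to_spin_bond_map :
    (¬ ∃ Φ : ↥(Algebra.adjoin ℂ bondSet) →ₐ[ℂ] Matrix (Fin 6 → Fin 2) (Fin 6 → Fin 2) ℂ,
        Function.Injective Φ ∧
        ∀ (p : ℕ × ℕ) (hp : p ∈ loopLinks),
          Φ ⟨hop p.1 p.2, hop_mem_adjoin p hp⟩
            = siteOp 6 sigmaPlus p.1 * siteOp 6 sigmaMinus p.2) ∧
    loopFC ≠ loopFC' ∧
    loopFC = (nOp 6 2 - nOp 6 1) ^ 2 * ((1 - (2 : ℂ) • nOp 6 3) * (1 - (2 : ℂ) • nOp 6 4)) ∧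
    loopFC' = (nOp 6 2 - nOp 6 1) ^ 2 * ((1 - (2 : ℂ) • nOp 6 5) * (1 - (2 : ℂ) • nOp 6 6)) ∧
    (∀ Φ : ↥(Algebra.adjoin ℂ bondSet) →ₐ[ℂ] Matrix (Fin 6 → Fin 2) (Fin 6 → Fin 2) ℂ,
      (∀ (p : ℕ × ℕ) (hp : p ∈ loopLinks),
        Φ ⟨hop p.1 p.2, hop_mem_adjoin p hp⟩
          = siteOp 6 sigmaPlus p.1 * siteOp 6 sigmaMinus p.2) →
      Φ ⟨loopFC, loopFC_mem⟩ = ((1 : ℂ) / 2) • (1 - siteOp 6 pauliZ 1 * siteOp 6 pauliZ 2) ∧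
      Φ ⟨loopFC', loopFC'_mem⟩ = ((1 : ℂ) / 2) • (1 - siteOp 6 pauliZ 1 * siteOp 6 pauliZ 2)) := by
  have image : ∀ Φ : ↥(Algebra.adjoin ℂ bondSet) →ₐ[ℂ] Matrix (Fin 6 → Fin 2) (Fin 6 → Fin 2) ℂ,
      (∀ (p : ℕ × ℕ) (hp : p ∈ loopLinks),
        Φ ⟨hop p.1 p.2, hop_mem_adjoin p hp⟩
          = siteOp 6 sigmaPlus p.1 * siteOp 6 sigmaMinus p.2) →
      Φ ⟨loopFC, loopFC_mem⟩ = ((1 : ℂ) / 2) • (1 - siteOp 6 pauliZ 1 * siteOp 6 pauliZ 2) ∧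
      Φ ⟨loopFC', loopFC'_mem⟩ = ((1 : ℂ) / 2) • (1 - siteOp 6 pauliZ 1 * siteOp 6 pauliZ 2) :=
    fun Φ hΦ =>
      ⟨(map_loop hΦ (1, 3) (3, 4) (4, 2) (2, 1) (by decide) (by decide) (by decide)
          (by decide)).trans
        (antiC_spinBond_loop (N := 6) (i := 0) (j := 2) (k := 3) (l := 1) (by decide)
          (by decide) (by decide) (by decide) (by decide)),
      (map_loop hΦ (1, 5) (5, 6) (6, 2) (2, 1) (by decide) (by decide) (by decide)
          (by decide)).trans
        (antiC_spinBond_loop (N := 6) (i := 0) (j := 4) (k := 5) (l := 1) (by decide)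
          (by decide) (by decide) (by decide) (by decide))⟩
  refine ⟨?_, loopFC_ne_loopFC', loopFC_eq, loopFC'_eq, image⟩
  rintro ⟨Φ, hinj, hΦ⟩
  obtain ⟨h, h'⟩ := image Φ hΦ
  exact loopFC_ne_loopFC' (congrArg Subtype.val (hinj (h.trans h'.symm)))
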